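/- Let n and k be integers with 3 ≤ k ≤ n−2, and let T be a tree on n vertices with exactly k pendent vertices (vertices of degree 1). Then H(T) ≤ H(BS_{n,k}), with equality if and only if T is isomorphic to BS_{n,k}. -/

import Mathlib

open Finset SimpleGraph

open Classical in
/-- The Harary index: half the sum, over ordered pairs of distinct vertices, of the
reciprocal of the shortest-path distance (so each unordered pair is counted once). -/
noncomputable def harary {V : Type*} [Fintype V] (G : SimpleGraph V) : ℝ :=
  (∑ u : V, ∑ v : V, if u = v then 0 else (1 : ℝ) / (G.dist u v)) / 2

/-- The path graph `P_n` on `n` vertices. -/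
def pathG (n : ℕ) : SimpleGraph (Fin n) :=
  SimpleGraph.fromRel (fun x y => (y : ℕ) = (x : ℕ) + 1)

/-- The star graph `S_n` on `n` vertices, with center `0`. -/
def starG (n : ℕ) : SimpleGraph (Fin n) :=
  SimpleGraph.fromRel (fun x y => (x : ℕ) = 0 ∧ (y : ℕ) ≠ 0)

/-- The spider (starlike tree) `S(L 0, …, L (k-1))`: a center `none` together with `k`
disjoint paths, the `i`-th having `L i` vertices, the center joined to vertex `0` of each leg. -/
def spider {k : ℕ} (L : Fin k → ℕ) : SimpleGraph (Option (Σ i : Fin k, Fin (L i))) :=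
  SimpleGraph.fromRel (fun x y =>
    (∃ (i : Fin k) (j : Fin (L i)), x = none ∧ y = some ⟨i, j⟩ ∧ (j : ℕ) = 0) ∨
    (∃ (i : Fin k) (j j' : Fin (L i)),
      x = some ⟨i, j⟩ ∧ y = some ⟨i, j'⟩ ∧ (j' : ℕ) = (j : ℕ) + 1))

/-- Leg lengths of the balanced starlike tree `BS n k`: the legs sum to `n - 1` and
pairwise differ by at most `1`. -/
def balancedLegs (n k : ℕ) : Fin k → ℕ :=
  fun i => (n - 1) / k + if (i : ℕ) < (n - 1) % k then 1 else 0

/-- The balanced starlike tree `BS_{n,k}` on `n` vertices with `k` legs of almost equal length. -/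
def BS (n k : ℕ) : SimpleGraph (Option (Σ i : Fin k, Fin (balancedLegs n k i))) :=
  spider (balancedLegs n k)

/-- Leg lengths of the broom `B_{n,k}`: one leg with `n - k` vertices, `k - 1` legs with one. -/
def broomLegs (n k : ℕ) : Fin k → ℕ := fun i => if (i : ℕ) = 0 then n - k else 1

/-- The broom `B_{n,k} = S(n-k, 1, …, 1)`. -/
def broom (n k : ℕ) : SimpleGraph (Option (Σ i : Fin k, Fin (broomLegs n k i))) :=
  spider (broomLegs n k)

/-- Leg lengths of the spur `A_{n,m}`: `n - m - 1` legs with two vertices, the rest with one. -/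
def spurLegs (n m : ℕ) : Fin m → ℕ := fun i => if (i : ℕ) < n - m - 1 then 2 else 1

/-- The spur `A_{n,m}`: the star `S_{m+1}` with a pendent edge attached to `n - m - 1`
of its pendent vertices. -/
def spur (n m : ℕ) : SimpleGraph (Option (Σ i : Fin m, Fin (spurLegs n m i))) :=
  spider (spurLegs n m)

/-- The caterpillar `C_{n,d,i}`: a path `v_0 v_1 … v_d` with `n - d - 1` pendent
vertices attached at `v_i`. -/
def caterpillar (n d i : ℕ) : SimpleGraph (Fin (d + 1) ⊕ Fin (n - d - 1)) :=
  SimpleGraph.fromRel (fun x y =>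
    (∃ a b : Fin (d + 1), x = Sum.inl a ∧ y = Sum.inl b ∧ (b : ℕ) = (a : ℕ) + 1) ∨
    (∃ (a : Fin (d + 1)) (p : Fin (n - d - 1)), (a : ℕ) = i ∧ x = Sum.inl a ∧ y = Sum.inr p))

/-- Degree of a vertex. -/
noncomputable def deg {V : Type*} [Fintype V] (G : SimpleGraph V) (v : V) : ℕ :=
  (G.neighborSet v).ncard

/-- Eccentricity of a vertex: the maximum distance to another vertex. -/
noncomputable def ecc {V : Type*} [Fintype V] (G : SimpleGraph V) (v : V) : ℕ :=
  Finset.univ.sup fun u => G.dist v u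

/-- Diameter of a graph: the maximum eccentricity. -/
noncomputable def graphDiam {V : Type*} [Fintype V] (G : SimpleGraph V) : ℕ :=
  Finset.univ.sup fun v => ecc G v

/-- Radius of a graph: the minimum eccentricity. -/
noncomputable def graphRadius {V : Type*} [Fintype V] (G : SimpleGraph V) : ℕ :=
  sInf (Set.range fun v => ecc G v)

/-- Matching number: the maximum cardinality of a set of pairwise non-incident edges. -/
noncomputable def matchingNumber {V : Type*} [Fintype V] (G : SimpleGraph V) : ℕ :=
  sSup {k | ∃ M : Finset (Sym2 V), M.card = k ∧ (∀ e ∈ M, e ∈ G.edgeSet) ∧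
    ∀ e ∈ M, ∀ f ∈ M, e ≠ f → ∀ v : V, ¬(v ∈ e ∧ v ∈ f)}

/-- Independence number: the maximum cardinality of a set of pairwise non-adjacent vertices. -/
noncomputable def indepNum {V : Type*} [Fintype V] (G : SimpleGraph V) : ℕ :=
  sSup {k | ∃ s : Finset V, s.card = k ∧ ∀ u ∈ s, ∀ v ∈ s, u ≠ v → ¬ G.Adj u v}



namespace SimpleGraph

variable {V : Type*} {G : SimpleGraph V}

/-- `x` lies on a shortest path from `a` to `b`. -/
def Btw (G : SimpleGraph V) (a x b : V) : Prop := G.dist a x + G.dist x b = G.dist a b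

lemma Btw.symm {a x b : V} (h : G.Btw a x b) : G.Btw b x a := by
  unfold Btw at *
  have h1 := G.dist_comm (u := b) (v := x)
  have h2 := G.dist_comm (u := x) (v := a)
  have h3 := G.dist_comm (u := b) (v := a)
  omega

lemma btw_left (a b : V) : G.Btw a a b := by simp [Btw]

lemma btw_right (a b : V) : G.Btw a b b := by simp [Btw]

/-- Concatenating betweenness: if `x` is between `a` and `y`, and `y` between `a` and `b`,
then `x` is between `a` and `b`. -/
lemma Btw.trans (hG : G.Connected) {a x y b : V} (h : G.Btw a x y) (h' : G.Btw a y b) :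
    G.Btw a x b := by
  unfold Btw at *
  have := hG.dist_triangle (u := x) (v := y) (w := b)
  have := hG.dist_triangle (u := a) (v := x) (w := b)
  omega

lemma Btw.trans_right (hG : G.Connected) {a x y b : V} (h : G.Btw a x y) (h' : G.Btw a y b) :
    G.Btw x y b := by
  unfold Btw at *
  have := hG.dist_triangle (u := x) (v := y) (w := b)
  have := hG.dist_triangle (u := a) (v := x) (w := b)
  omega

lemma Connected.exists_btw (hG : G.Connected) (a b : V) {t : ℕ} (ht : t ≤ G.dist a b) :
    ∃ x, G.dist a x = t ∧ G.Btw a x b := by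
  obtain ⟨p, hp⟩ := hG.exists_walk_length_eq_dist a b
  refine ⟨p.getVert t, ?_⟩
  have h1 := dist_le (p.take t)
  have h2 := dist_le (p.drop t)
  have h3 := hG.dist_triangle (u := a) (v := p.getVert t) (w := b)
  rw [Walk.take_length] at h1
  rw [Walk.drop_length] at h2
  unfold Btw
  omega

lemma IsTree.walk_eq (hG : G.IsTree) {a b : V} {p q : G.Walk a b} (hp : p.IsPath)
    (hq : q.IsPath) : p = q :=
  congrArg Subtype.val ((hG.isAcyclic.subsingleton_path a b).elim ⟨p, hp⟩ ⟨q, hq⟩)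

lemma IsTree.length_eq_dist (hG : G.IsTree) {a b : V} {p : G.Walk a b} (hp : p.IsPath) :
    p.length = G.dist a b := by
  obtain ⟨q, hq, hl⟩ := hG.connected.exists_path_of_dist a b
  rw [hG.walk_eq hp hq, hl]

lemma Btw.eq_of_dist_eq (hG : G.IsTree) {a b x y : V} (hx : G.Btw a x b) (hy : G.Btw a y b)
    (h : G.dist a x = G.dist a y) : x = y := by
  obtain ⟨p, hp⟩ := hG.connected.exists_walk_length_eq_dist a x
  obtain ⟨p', hp'⟩ := hG.connected.exists_walk_length_eq_dist x b
  obtain ⟨q, hq⟩ := hG.connected.exists_walk_length_eq_dist a y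
  obtain ⟨q', hq'⟩ := hG.connected.exists_walk_length_eq_dist y b
  have e : p.append p' = q.append q' := by
    apply hG.walk_eq <;> apply Walk.isPath_of_length_eq_dist <;> rw [Walk.length_append]
    · rw [hp, hp']; exact hx
    · rw [hq, hq']; exact hy
  have h1 : (p.append p').getVert p.length = x := by simp [Walk.getVert_append]
  have h2 : (q.append q').getVert q.length = y := by simp [Walk.getVert_append]
  rw [← h1, ← h2, e, hp, hq, h]

/-- In a tree, every vertex between `a` and `b` lies on every walk from `a` to `b`. -/
lemma Btw.mem_support (hG : G.IsTree) {a b x : V} (hx : G.Btw a x b) (w : G.Walk a b) :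
    x ∈ w.support := by
  classical
  obtain ⟨p, hp⟩ := hG.connected.exists_walk_length_eq_dist a x
  obtain ⟨p', hp'⟩ := hG.connected.exists_walk_length_eq_dist x b
  have e : p.append p' = w.bypass := by
    apply hG.walk_eq
    · apply Walk.isPath_of_length_eq_dist
      rw [Walk.length_append, hp, hp']; exact hx
    · exact w.bypass_isPath
  apply w.support_bypass_subset_support
  rw [← e]
  simp

lemma btw_of_mem_support (hG : G.Connected) {a b x : V} {w : G.Walk a b}
    (hw : w.length = G.dist a b) (hx : x ∈ w.support) : G.Btw a x b := by
  classical
  have h := congrArg Walk.length (w.take_spec hx)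
  rw [Walk.length_append] at h
  have h1 := dist_le (w.takeUntil x hx)
  have h2 := dist_le (w.dropUntil x hx)
  have h3 := hG.dist_triangle (u := a) (v := x) (w := b)
  unfold Btw
  omega

/-- Geodesic triangles in a tree are tripods: a side is covered by the other two. -/
lemma Btw.or (hG : G.IsTree) {a b x : V} (hx : G.Btw a x b) (v : V) :
    G.Btw v x a ∨ G.Btw v x b := by
  obtain ⟨p, hp⟩ := hG.connected.exists_walk_length_eq_dist a v
  obtain ⟨q, hq⟩ := hG.connected.exists_walk_length_eq_dist v b
  rcases (Walk.mem_support_append_iff p q).1 (hx.mem_support hG (p.append q)) with h | h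
  · exact .inl (btw_of_mem_support hG.connected hp h).symm
  · exact .inr (btw_of_mem_support hG.connected hq h)

lemma IsTree.btw_or_btw_of_adj (hG : G.IsTree) {x y : V} (h : G.Adj x y) (v : V) :
    G.Btw v x y ∨ G.Btw v y x := by
  have hxy : G.dist x y = 1 := dist_eq_one_iff_adj.2 h
  have hyx : G.dist y x = 1 := dist_eq_one_iff_adj.2 h.symm
  obtain ⟨p, hp, hl⟩ := hG.connected.exists_path_of_dist v x
  by_cases hy : y ∈ p.support
  · exact .inr (btw_of_mem_support hG.connected hl hy)
  · left
    have := hG.length_eq_dist (hp.concat hy h)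
    rw [Walk.length_concat] at this
    unfold Btw
    omega

/-- Any three vertices of a tree have a median. -/
lemma IsTree.exists_median (hG : G.IsTree) (a b v : V) :
    ∃ m, G.Btw a m b ∧ G.Btw v m a ∧ G.Btw v m b := by
  classical
  have hc := hG.connected
  have hP : ∃ t ≤ G.dist a b, ∃ m, G.dist a m = t ∧ G.Btw a m b ∧ G.Btw v m a :=
    ⟨0, Nat.zero_le _, a, by simp, btw_left _ _, btw_right _ _⟩
  obtain ⟨t₀, ht₀, h₀⟩ := hP
  have hspec := Nat.findGreatest_spec
    (P := fun t => ∃ m, G.dist a m = t ∧ G.Btw a m b ∧ G.Btw v m a) ht₀ h₀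
  obtain ⟨m, hm, hmab, hmva⟩ := hspec
  set t := Nat.findGreatest (fun t => ∃ m, G.dist a m = t ∧ G.Btw a m b ∧ G.Btw v m a)
    (G.dist a b) with ht
  refine ⟨m, hmab, hmva, ?_⟩
  rcases eq_or_ne m b with rfl | hmb
  · exact btw_right _ _
  have hpos := hc.pos_dist_of_ne hmb
  obtain ⟨y, hy1, hy⟩ := hc.exists_btw m b (t := 1) hpos
  have hyab : G.Btw a y b := (hy.symm.trans hc hmab.symm).symm
  have hamy : G.Btw a m y := (hy.symm.trans_right hc hmab.symm).symm
  have hay : G.dist a y = t + 1 := by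
    unfold Btw at hamy; omega
  have hyva : ¬ G.Btw v y a := by
    intro h
    have hle : G.dist a y ≤ G.dist a b := by unfold Btw at hyab; omega
    have := Nat.le_findGreatest
      (P := fun t => ∃ m, G.dist a m = t ∧ G.Btw a m b ∧ G.Btw v m a) hle ⟨y, rfl, hyab, h⟩
    omega
  have hyvb : G.Btw v y b := (hyab.or hG v).resolve_left hyva
  rcases hG.btw_or_btw_of_adj (dist_eq_one_iff_adj.1 hy1) v with h | h
  · exact h.trans hc hyvb
  · exact absurd (h.trans hc hmva) hyva

lemma Btw.eq_or_eq_of_leaf [Fintype V] (hG : G.IsTree) {a b x : V} (hx : G.Btw a x b)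
    (hd : deg G x = 1) : x = a ∨ x = b := by
  have hc := hG.connected
  by_contra! h
  obtain ⟨w, hw⟩ := Set.ncard_eq_one.1 hd
  have key : ∀ c, x ≠ c → G.dist x w + G.dist w c = G.dist x c := by
    intro c hxc
    obtain ⟨y, hy1, hy⟩ := hc.exists_btw x c (t := 1) (hc.pos_dist_of_ne hxc)
    have : y ∈ G.neighborSet x := dist_eq_one_iff_adj.1 hy1
    rw [hw, Set.mem_singleton_iff] at this
    exact this ▸ hy
  have h1 := key a h.1
  have h2 := key b h.2
  have hxw : G.dist x w = 1 := dist_eq_one_iff_adj.2 (by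
    have : w ∈ G.neighborSet x := hw ▸ Set.mem_singleton w
    exact this)
  have h3 := hc.dist_triangle (u := a) (v := w) (w := b)
  unfold Btw at hx
  rw [G.dist_comm (u := a) (v := x)] at hx
  rw [G.dist_comm (u := a) (v := w)] at h3
  omega

/-- Every geodesic of a finite tree extends to a leaf. -/
lemma IsTree.exists_leaf_btw [Fintype V] [Nontrivial V] (hG : G.IsTree) (c x : V) :
    ∃ l, deg G l = 1 ∧ G.Btw c x l := by
  classical
  have hc := hG.connected
  obtain ⟨y, hy, hmax⟩ := Finset.exists_max_image (Finset.univ.filter fun y => G.Btw c x y)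
    (G.dist c) ⟨x, by simp [btw_right]⟩
  simp only [Finset.mem_filter, Finset.mem_univ, true_and] at hy hmax
  have hyc : y ≠ c := by
    rintro rfl
    obtain ⟨z, hz⟩ := exists_ne y
    have hxy : x = y := by
      unfold Btw at hy
      rw [dist_self] at hy
      exact (hc.dist_eq_zero_iff.1 (by omega)).symm
    have := hmax z (hxy ▸ btw_left _ _)
    rw [dist_self] at this
    have := hc.pos_dist_of_ne hz.symm
    omega
  refine ⟨y, ?_, hy⟩
  have hn : ∀ z, G.Adj y z → G.Btw c z y := by
    intro z hz
    rcases hG.btw_or_btw_of_adj hz c with h | h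
    · have h1 := hmax z (hy.trans hc h)
      have h2 := hc.pos_dist_of_ne hz.ne
      unfold Btw at h
      omega
    · exact h
  obtain ⟨z, hz1, hz⟩ := hc.exists_btw y c (t := 1) (hc.pos_dist_of_ne hyc)
  refine Set.ncard_eq_one.2 ⟨z, Set.eq_singleton_iff_unique_mem.2
    ⟨dist_eq_one_iff_adj.1 hz1, fun u hu => ?_⟩⟩
  exact (hn u hu).symm.eq_of_dist_eq hG hz (by rw [hz1]; exact dist_eq_one_iff_adj.2 hu)

end SimpleGraph

/-- Sum of the reciprocal distances between distinct vertices of a path with `a` edges. -/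
noncomputable def legSum (a : ℕ) : ℝ :=
  ∑ i ∈ range a, ∑ t ∈ range (i + 1), 1 / ((t + 1 : ℕ) : ℝ)

/-- Sum of the reciprocal distances between the vertices of two legs of a spider. -/
noncomputable def crossSum (a b : ℕ) : ℝ :=
  ∑ i ∈ range a, ∑ j ∈ range b, 1 / ((i + j + 2 : ℕ) : ℝ)

/-- The Harary index of the spider with the given list of leg lengths. -/
noncomputable def spiderHarary : List ℕ → ℝ
  | [] => 0
  | a :: l => legSum a + (l.map (crossSum a)).sum + spiderHarary l

/-- The entries of a list pairwise differ by at most one. -/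
def IsBal (l : List ℕ) : Prop := ∀ a ∈ l, ∀ b ∈ l, a ≤ b + 1

lemma crossSum_comm (a b : ℕ) : crossSum a b = crossSum b a := by
  unfold crossSum
  rw [Finset.sum_comm]
  simp only [add_comm]

lemma crossSum_succ (a c : ℕ) :
    crossSum (a + 1) c = crossSum a c + ∑ j ∈ range c, 1 / ((a + j + 2 : ℕ) : ℝ) := by
  unfold crossSum
  rw [Finset.sum_range_succ]

lemma legSum_add (a b : ℕ) : legSum (a + b) = legSum a + legSum b + crossSum a b := by
  induction b with
  | zero => simp [legSum, crossSum]
  | succ b ih =>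
    have h1 : legSum (a + (b + 1)) =
        legSum (a + b) + ∑ t ∈ range (b + 1 + a), 1 / ((t + 1 : ℕ) : ℝ) := by
      rw [← add_assoc]
      unfold legSum
      rw [Finset.sum_range_succ, show a + b + 1 = b + 1 + a by omega]
    have h2 : legSum (b + 1) = legSum b + ∑ t ∈ range (b + 1), 1 / ((t + 1 : ℕ) : ℝ) := by
      unfold legSum
      rw [Finset.sum_range_succ]
    have h3 : ∑ x ∈ range a, 1 / ((b + 1 + x + 1 : ℕ) : ℝ) =
        ∑ x ∈ range a, 1 / ((b + x + 2 : ℕ) : ℝ) :=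
      Finset.sum_congr rfl fun x _ => by rw [show b + 1 + x + 1 = b + x + 2 by omega]
    rw [h1, h2, ih, crossSum_comm a (b + 1), crossSum_succ, crossSum_comm b a,
      Finset.sum_range_add, h3]
    ring

lemma crossSum_balance_le {a b : ℕ} (h : b ≤ a) (c : ℕ) :
    crossSum (a + 1) c + crossSum b c ≤ crossSum a c + crossSum (b + 1) c := by
  rw [crossSum_succ, crossSum_succ]
  have : ∑ j ∈ range c, 1 / ((a + j + 2 : ℕ) : ℝ) ≤ ∑ j ∈ range c, 1 / ((b + j + 2 : ℕ) : ℝ) :=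
    Finset.sum_le_sum fun j _ =>
      one_div_le_one_div_of_le (by positivity) (by exact_mod_cast (by omega))
  linarith

lemma crossSum_balance_lt {a b c : ℕ} (h : b < a) (hc : 0 < c) :
    crossSum (a + 1) c + crossSum b c < crossSum a c + crossSum (b + 1) c := by
  rw [crossSum_succ, crossSum_succ]
  have : ∑ j ∈ range c, 1 / ((a + j + 2 : ℕ) : ℝ) < ∑ j ∈ range c, 1 / ((b + j + 2 : ℕ) : ℝ) :=
    Finset.sum_lt_sum_of_nonempty (Finset.nonempty_range_iff.2 hc.ne') fun j _ =>
      one_div_lt_one_div_of_lt (by positivity) (by exact_mod_cast (by omega))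
  linarith

lemma spiderHarary_perm {l l' : List ℕ} (h : l.Perm l') : spiderHarary l = spiderHarary l' := by
  induction h with
  | nil => rfl
  | cons a h ih => simp only [spiderHarary, ih, (h.map (crossSum a)).sum_eq]
  | swap a b l =>
    simp only [spiderHarary, List.map_cons, List.sum_cons, crossSum_comm b a]
    ring
  | trans _ _ ih₁ ih₂ => exact ih₁.trans ih₂

lemma spiderHarary_cons_cons (a b : ℕ) (l : List ℕ) :
    spiderHarary (a :: b :: l) =
      legSum (a + b) + (l.map fun c => crossSum a c + crossSum b c).sum + spiderHarary l := by
  simp only [spiderHarary, List.map_cons, List.sum_cons, legSum_add, List.sum_map_add]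
  ring

lemma spiderHarary_balance_le {a b : ℕ} (h : b ≤ a) (l : List ℕ) :
    spiderHarary ((a + 1) :: b :: l) ≤ spiderHarary (a :: (b + 1) :: l) := by
  rw [spiderHarary_cons_cons, spiderHarary_cons_cons, show a + 1 + b = a + (b + 1) by omega]
  have := List.sum_le_sum (l := l) fun c _ => crossSum_balance_le h c
  linarith

lemma spiderHarary_balance_lt {a b : ℕ} (h : b < a) {l : List ℕ} (hl : l ≠ [])
    (hpos : ∀ c ∈ l, 0 < c) :
    spiderHarary ((a + 1) :: b :: l) < spiderHarary (a :: (b + 1) :: l) := by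
  rw [spiderHarary_cons_cons, spiderHarary_cons_cons, show a + 1 + b = a + (b + 1) by omega]
  have := List.sum_lt_sum_of_ne_nil hl _ _ fun c hc => crossSum_balance_lt h (hpos c hc)
  linarith

lemma exists_perm_of_not_isBal {l : List ℕ} (h : ¬ IsBal l) :
    ∃ a b l', b < a ∧ l.Perm ((a + 1) :: b :: l') := by
  unfold IsBal at h
  push Not at h
  obtain ⟨a, ha, b, hb, hab⟩ := h
  have h1 := List.perm_cons_erase ha
  have hb' : b ∈ l.erase a := (List.mem_erase_of_ne (by omega)).2 hb
  refine ⟨a - 1, b, (l.erase a).erase b, by omega, ?_⟩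
  rw [Nat.sub_add_cancel (by omega)]
  exact h1.trans ((List.perm_cons_erase hb').cons a)

lemma exists_isBal_spiderHarary_le (l : List ℕ) :
    ∃ l', IsBal l' ∧ l'.length = l.length ∧ l'.sum = l.sum ∧
      spiderHarary l ≤ spiderHarary l' := by
  induction hs : (l.map fun a => a ^ 2).sum using Nat.strong_induction_on generalizing l with
  | _ s ih =>
    by_cases hl : IsBal l
    · exact ⟨l, hl, rfl, rfl, le_rfl⟩
    obtain ⟨a, b, l₀, hab, hp⟩ := exists_perm_of_not_isBal hl
    obtain ⟨l', h1, h2, h3, h4⟩ := ih _ (by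
      rw [← hs, (hp.map _).sum_eq]
      simp only [List.map_cons, List.sum_cons]
      nlinarith) (a :: (b + 1) :: l₀) rfl
    refine ⟨l', h1, by rw [h2, hp.length_eq]; simp, ?_, ?_⟩
    · rw [h3, hp.sum_eq]
      simp only [List.sum_cons]
      omega
    · rw [spiderHarary_perm hp]
      exact (spiderHarary_balance_le hab.le l₀).trans h4

lemma sum_and_length_of_two_values {q : ℕ} {l : List ℕ} (h : ∀ a ∈ l, a = q ∨ a = q + 1) :
    l.sum = l.length * q + l.count (q + 1) ∧ l.length = l.count q + l.count (q + 1) := by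
  induction l with
  | nil => simp
  | cons a l ih =>
    obtain ⟨h1, h2⟩ := ih fun b hb => h b (by simp [hb])
    rw [List.sum_cons, List.length_cons, List.count_cons, List.count_cons]
    rcases h a (by simp) with rfl | rfl
    · simp
      constructor <;> linarith
    · simp
      constructor <;> linarith

lemma IsBal.exists_two_values {l : List ℕ} (h : IsBal l) (hl : l ≠ []) :
    ∀ a ∈ l, a = l.sum / l.length ∨ a = l.sum / l.length + 1 := by
  obtain ⟨q, hq, hmin⟩ := Finset.exists_min_image l.toFinset id (by simpa using hl)
  simp only [List.mem_toFinset, id] at hq hmin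
  have hv : ∀ a ∈ l, a = q ∨ a = q + 1 := fun a ha => by
    have := hmin a ha
    have := h a ha q hq
    omega
  obtain ⟨h1, h2⟩ := sum_and_length_of_two_values hv
  have hc : 0 < l.count q := List.count_pos_iff.2 hq
  have : l.sum / l.length = q := by
    rw [h1, Nat.mul_add_div (by omega), Nat.div_eq_of_lt (by omega), add_zero]
  rwa [this]

lemma IsBal.perm {l l' : List ℕ} (h : IsBal l) (h' : IsBal l') (hlen : l.length = l'.length)
    (hsum : l.sum = l'.sum) : l.Perm l' := by
  rcases eq_or_ne l [] with rfl | hl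
  · rw [List.length_nil] at hlen
    rw [List.eq_nil_of_length_eq_zero hlen.symm]
  have hl' : l' ≠ [] := by
    rintro rfl
    exact hl (List.eq_nil_of_length_eq_zero hlen)
  have hv := h.exists_two_values hl
  have hv' := h'.exists_two_values hl'
  rw [← hlen, ← hsum] at hv'
  set q := l.sum / l.length
  obtain ⟨h1, h2⟩ := sum_and_length_of_two_values hv
  obtain ⟨h3, h4⟩ := sum_and_length_of_two_values hv'
  rw [← hlen] at h3 h4
  refine List.perm_iff_count.2 fun a => ?_
  by_cases ha : a = q ∨ a = q + 1
  · rcases ha with rfl | rfl <;> omega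
  · rw [List.count_eq_zero_of_not_mem fun hm => ha (hv a hm),
      List.count_eq_zero_of_not_mem fun hm => ha (hv' a hm)]

lemma spiderHarary_le_of_isBal {l l' : List ℕ} (h' : IsBal l') (hlen : l.length = l'.length)
    (hsum : l.sum = l'.sum) : spiderHarary l ≤ spiderHarary l' := by
  obtain ⟨l₀, h1, h2, h3, h4⟩ := exists_isBal_spiderHarary_le l
  rwa [spiderHarary_perm (h1.perm h' (h2.trans hlen) (h3.trans hsum))] at h4

lemma spiderHarary_lt_of_isBal {l l' : List ℕ} (h' : IsBal l') (hlen : l.length = l'.length)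
    (hsum : l.sum = l'.sum) (h3 : 3 ≤ l.length) (hpos : ∀ c ∈ l, 0 < c) (hl : ¬ IsBal l) :
    spiderHarary l < spiderHarary l' := by
  obtain ⟨a, b, l₀, hab, hp⟩ := exists_perm_of_not_isBal hl
  have hlen' := hp.length_eq
  have hsum' := hp.sum_eq
  simp only [List.length_cons, List.sum_cons] at hlen' hsum'
  rw [spiderHarary_perm hp]
  refine (spiderHarary_balance_lt hab ?_ fun c hc => hpos c (hp.mem_iff.2 (by simp [hc]))).trans_le
    (spiderHarary_le_of_isBal h' ?_ ?_)
  · rintro rfl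
    simp at hlen'
    omega
  · simp only [List.length_cons]
    omega
  · simp only [List.sum_cons]
    omega

/-- Leg lengths of a balanced spider with `k` legs and `N` vertices besides the center. -/
def balList (k N : ℕ) : List ℕ :=
  List.ofFn fun i : Fin k => N / k + if (i : ℕ) < N % k then 1 else 0

lemma length_balList (k N : ℕ) : (balList k N).length = k := List.length_ofFn

lemma two_values_balList {k N a : ℕ} (ha : a ∈ balList k N) : a = N / k ∨ a = N / k + 1 := by
  obtain ⟨i, rfl⟩ := (List.mem_ofFn' _ _).1 ha
  by_cases h : (i : ℕ) < N % k <;> simp [h]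

lemma isBal_balList (k N : ℕ) : IsBal (balList k N) := by
  intro a ha b hb
  have := two_values_balList ha
  have := two_values_balList hb
  omega

lemma sum_balList {k : ℕ} (hk : 0 < k) (N : ℕ) : (balList k N).sum = N := by
  have h := Nat.mod_lt N hk
  rw [balList, List.sum_ofFn, Finset.sum_add_distrib,
    Fin.sum_univ_eq_sum_range (fun i => if i < N % k then 1 else 0) k, Finset.sum_boole]
  have : (range k).filter (fun i => i < N % k) = range (N % k) := by
    ext i
    simp only [Finset.mem_filter, Finset.mem_range]
    omega
  rw [this]
  simp [Nat.div_add_mod]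

lemma sum_map_sum_of_two_values {q : ℕ} {l : List ℕ} (h : ∀ a ∈ l, a = q ∨ a = q + 1)
    (g : ℕ → ℝ) :
    (l.map fun b => ∑ t ∈ range b, g (t + 1)).sum =
      l.length * ∑ t ∈ range q, (g (t + 1) - g (q + 1)) + l.sum * g (q + 1) := by
  induction l with
  | nil => simp
  | cons a l ih =>
    rw [List.map_cons, List.sum_cons, ih fun b hb => h b (by simp [hb]), List.sum_cons,
      List.length_cons]
    simp only [Finset.sum_sub_distrib, Finset.sum_const, Finset.card_range, nsmul_eq_mul]
    rcases h a (by simp) with rfl | rfl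
    · push_cast
      ring
    · rw [Finset.sum_range_succ]
      push_cast
      ring

section Levels

variable {α : Type*} {S : Finset α} {δ : α → ℕ} {l : List ℕ} {q : ℕ} {g : ℕ → ℝ}

lemma sum_sub_le_sum_levels (h0 : #{x ∈ S | δ x = 0} = 1) (hg : Antitone g) :
    ∑ x ∈ S, (g (δ x) - g (q + 1)) ≤ (g 0 - g (q + 1)) +
      ∑ t ∈ range q, #{x ∈ S | δ x = t + 1} * (g (t + 1) - g (q + 1)) := by
  calc ∑ x ∈ S, (g (δ x) - g (q + 1))
      ≤ ∑ x ∈ S, ∑ t ∈ range (q + 1), if δ x = t then g t - g (q + 1) else 0 := by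
        refine Finset.sum_le_sum fun x _ => ?_
        rw [Finset.sum_ite_eq]
        split_ifs with h
        · exact le_rfl
        · have := hg (show q + 1 ≤ δ x by simpa using h)
          linarith
    _ = ∑ t ∈ range (q + 1), #{x ∈ S | δ x = t} * (g t - g (q + 1)) := by
        rw [Finset.sum_comm]
        refine Finset.sum_congr rfl fun t _ => ?_
        rw [← Finset.sum_filter, Finset.sum_const, nsmul_eq_mul]
    _ = _ := by
        rw [Finset.sum_range_succ', h0]
        push_cast
        ring

/-- If the levels of a height function contain at most `l.length` elements, then sums of an
antitone function are at most those for a balanced spider with leg lengths `l`. -/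
lemma sum_levels_le (h0 : #{x ∈ S | δ x = 0} = 1)
    (hlev : ∀ t, #{x ∈ S | δ x = t + 1} ≤ l.length) (hl : ∀ a ∈ l, a = q ∨ a = q + 1)
    (hcard : #S = l.sum + 1) (hg : Antitone g) :
    ∑ x ∈ S, g (δ x) ≤ g 0 + (l.map fun b => ∑ t ∈ range b, g (t + 1)).sum := by
  have h := sum_sub_le_sum_levels (q := q) h0 hg
  rw [Finset.sum_sub_distrib, Finset.sum_const, nsmul_eq_mul, hcard] at h
  rw [sum_map_sum_of_two_values hl, Finset.mul_sum]
  have h2 : ∑ t ∈ range q, #{x ∈ S | δ x = t + 1} * (g (t + 1) - g (q + 1)) ≤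
      ∑ t ∈ range q, (l.length : ℝ) * (g (t + 1) - g (q + 1)) := by
    refine Finset.sum_le_sum fun t ht => ?_
    have ht' : t + 1 ≤ q + 1 := by have := Finset.mem_range.1 ht; omega
    exact mul_le_mul_of_nonneg_right (by exact_mod_cast hlev t) (sub_nonneg.2 (hg ht'))
  rw [Nat.cast_add, Nat.cast_one] at h
  linarith

lemma sum_levels_lt (h0 : #{x ∈ S | δ x = 0} = 1)
    (hlev : ∀ t, #{x ∈ S | δ x = t + 1} ≤ l.length) (hl : ∀ a ∈ l, a = q ∨ a = q + 1)
    (hcard : #S = l.sum + 1) (hg : StrictAnti g) (hq : 0 < q)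
    (h1 : #{x ∈ S | δ x = 1} < l.length) :
    ∑ x ∈ S, g (δ x) < g 0 + (l.map fun b => ∑ t ∈ range b, g (t + 1)).sum := by
  have h := sum_sub_le_sum_levels (q := q) h0 hg.antitone
  rw [Finset.sum_sub_distrib, Finset.sum_const, nsmul_eq_mul, hcard] at h
  rw [sum_map_sum_of_two_values hl, Finset.mul_sum]
  have h2 : ∑ t ∈ range q, #{x ∈ S | δ x = t + 1} * (g (t + 1) - g (q + 1)) <
      ∑ t ∈ range q, (l.length : ℝ) * (g (t + 1) - g (q + 1)) := by
    refine Finset.sum_lt_sum (fun t ht => ?_) ⟨0, Finset.mem_range.2 hq, ?_⟩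
    · have ht' : t + 1 ≤ q + 1 := by have := Finset.mem_range.1 ht; omega
      exact mul_le_mul_of_nonneg_right (by exact_mod_cast hlev t)
        (sub_nonneg.2 (hg.antitone ht'))
    · exact mul_lt_mul_of_pos_right (by exact_mod_cast h1) (sub_pos.2 (hg (by omega)))
  rw [Nat.cast_add, Nat.cast_one] at h
  linarith

end Levels

lemma sum_range_path (m : ℕ) :
    ∑ i ∈ range m, ∑ j ∈ range m, 1 / ((i - j + (j - i) : ℕ) : ℝ) =
      2 * ∑ i ∈ range m, ∑ t ∈ range i, 1 / ((t + 1 : ℕ) : ℝ) := by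
  induction m with
  | zero => simp
  | succ m ih =>
    have hr : ∑ j ∈ range m, 1 / ((m - j + (j - m) : ℕ) : ℝ) =
        ∑ t ∈ range m, 1 / ((t + 1 : ℕ) : ℝ) := by
      rw [← Finset.sum_range_reflect]
      refine Finset.sum_congr rfl fun j hj => ?_
      have := Finset.mem_range.1 hj
      congr 2
      omega
    have hc : ∑ i ∈ range m, 1 / ((i - m + (m - i) : ℕ) : ℝ) =
        ∑ t ∈ range m, 1 / ((t + 1 : ℕ) : ℝ) := by
      rw [← hr]
      exact Finset.sum_congr rfl fun j _ => by rw [add_comm]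
    rw [Finset.sum_range_succ, Finset.sum_range_succ _ m, hr,
      Finset.sum_congr rfl fun i _ => Finset.sum_range_succ _ m, Finset.sum_add_distrib, ih, hc,
      Finset.sum_range_succ (fun i => ∑ t ∈ range i, 1 / ((t + 1 : ℕ) : ℝ))]
    simp
    ring

lemma legSum_eq (m : ℕ) :
    legSum m = ∑ i ∈ range m, 1 / ((i + 1 : ℕ) : ℝ) +
      ∑ i ∈ range m, ∑ t ∈ range i, 1 / ((t + 1 : ℕ) : ℝ) := by
  unfold legSum
  rw [← Finset.sum_add_distrib]
  exact Finset.sum_congr rfl fun i _ => by rw [Finset.sum_range_succ, add_comm]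

lemma sum_range_map_crossSum (m : ℕ) (l : List ℕ) :
    ∑ i ∈ range m, (l.map fun b => ∑ t ∈ range b, 1 / ((t + 1 + (i + 1) : ℕ) : ℝ)).sum =
      (l.map (crossSum m)).sum := by
  induction l with
  | nil => simp
  | cons a l ih =>
    simp only [List.map_cons, List.sum_cons, Finset.sum_add_distrib, ih, crossSum]
    congr 1
    refine Finset.sum_congr rfl fun i _ => Finset.sum_congr rfl fun t _ => ?_
    congr 2
    omega

lemma strictAnti_one_div_add (i : ℕ) : StrictAnti fun t : ℕ => 1 / ((t + (i + 1) : ℕ) : ℝ) :=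
  fun s t h => one_div_lt_one_div_of_lt (by positivity) (by exact_mod_cast (by omega))

namespace SimpleGraph

variable {V : Type*} {G : SimpleGraph V}

/-- Sum of the reciprocal distances over ordered pairs of vertices of `S`. -/
noncomputable def recipSum (G : SimpleGraph V) (S : Finset V) : ℝ :=
  ∑ x ∈ S, ∑ y ∈ S, 1 / (G.dist x y : ℝ)

lemma harary_eq [Fintype V] (G : SimpleGraph V) : harary G = G.recipSum univ / 2 := by
  unfold harary recipSum
  congr 1
  refine Finset.sum_congr rfl fun x _ => Finset.sum_congr rfl fun y _ => ?_
  split_ifs with h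
  · simp [h]
  · rfl

lemma Btw.btw_of_dist_le (hG : G.IsTree) {a b x y : V} (hx : G.Btw a x b) (hy : G.Btw a y b)
    (h : G.dist a x ≤ G.dist a y) : G.Btw a x y := by
  obtain ⟨z, hz1, hz⟩ := hG.connected.exists_btw a y h
  rwa [hx.eq_of_dist_eq hG (hz.trans hG.connected hy) hz1.symm]

open Classical in
/-- The vertices on the geodesics from `c` to the vertices of `A`, together with `c`. -/
noncomputable def hull [Fintype V] (G : SimpleGraph V) (c : V) (A : Finset V) : Finset V :=
  {x | x = c ∨ ∃ a ∈ A, G.Btw c x a}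

variable [Fintype V] {c : V} {A : Finset V}

lemma mem_hull {x : V} : x ∈ G.hull c A ↔ x = c ∨ ∃ a ∈ A, G.Btw c x a := by
  simp [hull]

lemma hull_empty : G.hull c ∅ = {c} := by
  ext x
  simp [mem_hull]

lemma exists_btw_of_mem_hull [DecidableEq V] (hG : G.IsTree) {x : V} (hx : x ∈ G.hull c A)
    (v : V) : ∃ a ∈ insert c A, G.Btw v x a := by
  rcases mem_hull.1 hx with rfl | ⟨a, ha, h⟩
  · exact ⟨x, by simp, btw_right _ _⟩
  · rcases h.or hG v with h | h
    · exact ⟨c, by simp, h⟩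
    · exact ⟨a, by simp [ha], h⟩

lemma card_level_hull_le [DecidableEq V] (hG : G.IsTree) (v : V) (t : ℕ) :
    #{x ∈ G.hull c A | G.dist v x = t} ≤ #(insert c A) := by
  have hex : ∀ x, ∃ a, x ∈ G.hull c A → a ∈ insert c A ∧ G.Btw v x a := fun x => by
    by_cases hx : x ∈ G.hull c A
    · obtain ⟨a, ha⟩ := exists_btw_of_mem_hull hG hx v
      exact ⟨a, fun _ => ha⟩
    · exact ⟨x, fun h => absurd h hx⟩
  choose f hf using hex
  refine Finset.card_le_card_of_injOn f (fun x hx => ?_) (fun x hx y hy hxy => ?_)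
  · exact (hf x (Finset.mem_filter.1 hx).1).1
  · obtain ⟨hx1, hx2⟩ := Finset.mem_filter.1 (Finset.mem_coe.1 hx)
    obtain ⟨hy1, hy2⟩ := Finset.mem_filter.1 (Finset.mem_coe.1 hy)
    exact (hf x hx1).2.eq_of_dist_eq hG (hxy ▸ (hf y hy1).2) (hx2.trans hy2.symm)

lemma Btw.mem_hull (hG : G.IsTree) {x y z : V} (hx : x ∈ G.hull c A) (hy : y ∈ G.hull c A)
    (h : G.Btw x z y) : z ∈ G.hull c A := by
  have key : ∀ x ∈ G.hull c A, G.Btw c z x → z ∈ G.hull c A := by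
    intro x hx hz
    rcases SimpleGraph.mem_hull.1 hx with rfl | ⟨a, ha, hxa⟩
    · refine SimpleGraph.mem_hull.2 (.inl ?_)
      unfold Btw at hz
      rw [dist_self] at hz
      exact (hG.connected.dist_eq_zero_iff.1 (by omega)).symm
    · exact SimpleGraph.mem_hull.2 (.inr ⟨a, ha, hz.trans hG.connected hxa⟩)
  rcases h.or hG c with h | h
  · exact key x hx h
  · exact key y hy h

/-- Every vertex `a` has a gate in the hull, through which all geodesics to `a` pass. -/
lemma exists_gate (hG : G.IsTree) (c : V) (A : Finset V) (a : V) :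
    ∃ v ∈ G.hull c A, ∀ x ∈ G.hull c A, G.Btw x v a := by
  obtain ⟨v, hv, hmin⟩ := Finset.exists_min_image (G.hull c A) (G.dist a)
    ⟨c, mem_hull.2 (.inl rfl)⟩
  refine ⟨v, hv, fun x hx => ?_⟩
  obtain ⟨m, h1, h2, h3⟩ := hG.exists_median x v a
  have hm := hmin m (h1.mem_hull hG hx hv)
  have : m = v := hG.connected.dist_eq_zero_iff.1 (by unfold Btw at h3; omega)
  exact (this ▸ h2).symm

/-- The hull grows by a pendent path when a vertex is added. -/
lemma hull_insert [DecidableEq V] (hG : G.IsTree) {a v : V} (hv : v ∈ G.hull c A)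
    (hgate : ∀ x ∈ G.hull c A, G.Btw x v a) :
    #(G.hull c (insert a A)) = #(G.hull c A) + G.dist v a ∧
    G.recipSum (G.hull c (insert a A)) = G.recipSum (G.hull c A) +
      2 * (∑ i ∈ range (G.dist v a), ∑ x ∈ G.hull c A, 1 / ((G.dist v x + (i + 1) : ℕ) : ℝ)) +
      2 * ∑ i ∈ range (G.dist v a), ∑ t ∈ range i, 1 / ((t + 1 : ℕ) : ℝ) := by
  have hc := hG.connected
  have hex : ∀ i, ∃ x, i < G.dist v a → G.dist v x = i + 1 ∧ G.Btw v x a := fun i => by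
    by_cases hi : i < G.dist v a
    · obtain ⟨x, hx⟩ := hc.exists_btw v a hi
      exact ⟨x, fun _ => hx⟩
    · exact ⟨v, fun h => absurd h hi⟩
  choose p hp using hex
  set m := G.dist v a with hm
  have hcv : G.Btw c v a := hgate c (mem_hull.2 (.inl rfl))
  have hinj : Set.InjOn p (range m : Set ℕ) := by
    intro i hi j hj hij
    have h1 := (hp i (by simpa using hi)).1
    have h2 := (hp j (by simpa using hj)).1
    rw [hij] at h1
    omega
  have hcross : ∀ x ∈ G.hull c A, ∀ i < m, G.dist x (p i) = G.dist v x + (i + 1) := by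
    intro x hx i hi
    obtain ⟨h1, h2⟩ := hp i hi
    have h3 := hgate x hx
    have h4 := hc.dist_triangle (u := x) (v := p i) (w := a)
    have h5 := hc.dist_triangle (u := x) (v := v) (w := p i)
    have h6 := G.dist_comm (u := x) (v := v)
    unfold Btw at h2 h3
    omega
  have hdisj : Disjoint (G.hull c A) ((range m).image p) := by
    rw [Finset.disjoint_left]
    intro x hx hx'
    obtain ⟨i, hi, rfl⟩ := Finset.mem_image.1 hx'
    have := hcross _ hx i (Finset.mem_range.1 hi)
    rw [dist_self] at this
    omega
  have hunion : G.hull c (insert a A) = G.hull c A ∪ (range m).image p := by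
    ext x
    rw [Finset.mem_union]
    constructor
    · intro hx
      by_cases hxA : x ∈ G.hull c A
      · exact .inl hxA
      right
      rcases mem_hull.1 hx with rfl | ⟨b, hb, hxb⟩
      · exact absurd (mem_hull.2 (.inl rfl)) hxA
      rcases Finset.mem_insert.1 hb with rfl | hb
      · rcases hxb.or hG v with h | h
        · exact absurd (h.mem_hull hG hv (mem_hull.2 (.inl rfl))) hxA
        have hne : v ≠ x := fun h => hxA (h ▸ hv)
        have hpos := hc.pos_dist_of_ne hne
        have hle : G.dist v x ≤ m := by unfold Btw at h; omega
        have hi : G.dist v x - 1 < m := by omega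
        refine Finset.mem_image.2 ⟨G.dist v x - 1, Finset.mem_range.2 hi, ?_⟩
        obtain ⟨h1, h2⟩ := hp _ hi
        exact h2.eq_of_dist_eq hG h (by omega)
      · exact absurd (mem_hull.2 (.inr ⟨b, hb, hxb⟩)) hxA
    · rintro (hx | hx)
      · rcases mem_hull.1 hx with rfl | ⟨b, hb, hxb⟩
        · exact mem_hull.2 (.inl rfl)
        · exact mem_hull.2 (.inr ⟨b, by simp [hb], hxb⟩)
      · obtain ⟨i, hi, rfl⟩ := Finset.mem_image.1 hx
        obtain ⟨-, h2⟩ := hp i (Finset.mem_range.1 hi)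
        exact mem_hull.2 (.inr ⟨a, by simp, (h2.symm.trans hc hcv.symm).symm⟩)
  refine ⟨?_, ?_⟩
  · rw [hunion, Finset.card_union_of_disjoint hdisj, Finset.card_image_of_injOn hinj,
      Finset.card_range]
  have hPP : ∑ x ∈ (range m).image p, ∑ y ∈ (range m).image p, 1 / (G.dist x y : ℝ) =
      2 * ∑ i ∈ range m, ∑ t ∈ range i, 1 / ((t + 1 : ℕ) : ℝ) := by
    rw [← sum_range_path, Finset.sum_image hinj]
    refine Finset.sum_congr rfl fun i hi => ?_
    rw [Finset.sum_image hinj]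
    refine Finset.sum_congr rfl fun j hj => ?_
    obtain ⟨h1, h2⟩ := hp i (Finset.mem_range.1 hi)
    obtain ⟨h3, h4⟩ := hp j (Finset.mem_range.1 hj)
    congr 2
    rcases le_total i j with h | h
    · have := h2.btw_of_dist_le hG h4 (by omega)
      unfold Btw at this
      omega
    · have := h4.btw_of_dist_le hG h2 (by omega)
      unfold Btw at this
      rw [G.dist_comm (u := p i)]
      omega
  have hSP : ∑ x ∈ G.hull c A, ∑ y ∈ (range m).image p, 1 / (G.dist x y : ℝ) =
      ∑ i ∈ range m, ∑ x ∈ G.hull c A, 1 / ((G.dist v x + (i + 1) : ℕ) : ℝ) := by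
    rw [Finset.sum_comm, Finset.sum_image hinj]
    refine Finset.sum_congr rfl fun i hi => Finset.sum_congr rfl fun x hx => ?_
    rw [hcross x hx i (Finset.mem_range.1 hi)]
  have hPS : ∑ x ∈ (range m).image p, ∑ y ∈ G.hull c A, 1 / (G.dist x y : ℝ) =
      ∑ i ∈ range m, ∑ x ∈ G.hull c A, 1 / ((G.dist v x + (i + 1) : ℕ) : ℝ) := by
    rw [← hSP, Finset.sum_comm]
    simp only [G.dist_comm]
  unfold recipSum
  rw [hunion, Finset.sum_union hdisj]
  simp only [Finset.sum_union hdisj, Finset.sum_add_distrib]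
  rw [hPP, hSP, hPS]
  ring

lemma card_level_zero_hull (hG : G.IsTree) {v : V} (hv : v ∈ G.hull c A) :
    #{x ∈ G.hull c A | G.dist v x = 0} = 1 := by
  refine Finset.card_eq_one.2 ⟨v, ?_⟩
  ext x
  rw [Finset.mem_filter, Finset.mem_singleton, hG.connected.dist_eq_zero_iff]
  exact ⟨fun h => h.2.symm, fun h => ⟨h ▸ hv, h.symm⟩⟩

lemma card_hull_eq_sum_balList {k : ℕ} (hk : 0 < k) :
    #(G.hull c A) = (balList k (#(G.hull c A) - 1)).sum + 1 := by
  have : 0 < #(G.hull c A) := Finset.card_pos.2 ⟨c, mem_hull.2 (.inl rfl)⟩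
  rw [sum_balList hk]
  omega

lemma sum_cross_eq (m : ℕ) (l : List ℕ) :
    ∑ i ∈ range m, (1 / ((0 + (i + 1) : ℕ) : ℝ) +
      (l.map fun b => ∑ t ∈ range b, 1 / ((t + 1 + (i + 1) : ℕ) : ℝ)).sum) +
      ∑ i ∈ range m, ∑ t ∈ range i, 1 / ((t + 1 : ℕ) : ℝ) =
    legSum m + (l.map (crossSum m)).sum := by
  rw [legSum_eq, Finset.sum_add_distrib, sum_range_map_crossSum]
  simp only [zero_add]
  ring

lemma recipSum_hull_le (hG : G.IsTree) (c : V) (A : Finset V) (hcA : c ∉ A) :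
    G.recipSum (G.hull c A) ≤
      2 * spiderHarary (balList (#A + 1) (#(G.hull c A) - 1)) := by
  classical
  induction A using Finset.induction_on with
  | empty => simp [hull_empty, recipSum, balList, spiderHarary, legSum]
  | insert a A ha ih =>
    have hcA' : c ∉ A := fun h => hcA (by simp [h])
    obtain ⟨v, hv, hgate⟩ := exists_gate hG c A a
    obtain ⟨hcard, hsum⟩ := hull_insert hG hv hgate
    have hcross : ∀ i ∈ range (G.dist v a), ∑ x ∈ G.hull c A, _ ≤ _ := fun i _ =>
      sum_levels_le (l := balList (#A + 1) (#(G.hull c A) - 1)) (card_level_zero_hull hG hv)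
        (fun t => by
          rw [length_balList, ← Finset.card_insert_of_notMem hcA']
          exact card_level_hull_le hG v (t + 1))
        (fun _ => two_values_balList) (card_hull_eq_sum_balList (Nat.succ_pos _))
        (strictAnti_one_div_add i).antitone
    have hle := Finset.sum_le_sum hcross
    have heq := sum_cross_eq (G.dist v a) (balList (#A + 1) (#(G.hull c A) - 1))
    have hpos := card_hull_eq_sum_balList (G := G) (c := c) (A := A) (Nat.succ_pos #A)
    have hbal := spiderHarary_le_of_isBal
      (l := G.dist v a :: balList (#A + 1) (#(G.hull c A) - 1))
      (isBal_balList (#(insert a A) + 1) (#(G.hull c (insert a A)) - 1))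
      (by simp [length_balList, Finset.card_insert_of_notMem ha])
      (by
        rw [List.sum_cons, sum_balList (Nat.succ_pos _), sum_balList (Nat.succ_pos _), hcard]
        omega)
    rw [spiderHarary] at hbal
    have := ih hcA'
    rw [hsum]
    linarith

/-- The bound of `recipSum_hull_le` is strict when a vertex is added to the hull through a gate
with too few neighbors in the hull. -/
lemma recipSum_hull_insert_lt [DecidableEq V] (hG : G.IsTree) {a v : V} (hcA : c ∉ A)
    (hv : v ∈ G.hull c A) (hgate : ∀ x ∈ G.hull c A, G.Btw x v a) (hva : v ≠ a)
    (hbig : #A + 1 < #(G.hull c A)) (hdeg : #{x ∈ G.hull c A | G.dist v x = 1} < #A + 1) :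
    G.recipSum (G.hull c (insert a A)) <
      2 * spiderHarary (balList (#A + 2) (#(G.hull c (insert a A)) - 1)) := by
  obtain ⟨hcard, hsum⟩ := hull_insert hG hv hgate
  have hcross : ∀ i ∈ range (G.dist v a), ∑ x ∈ G.hull c A, _ < _ := fun i _ =>
    sum_levels_lt (l := balList (#A + 1) (#(G.hull c A) - 1)) (card_level_zero_hull hG hv)
      (fun t => by
        rw [length_balList, ← Finset.card_insert_of_notMem hcA]
        exact card_level_hull_le hG v (t + 1))
      (fun _ => two_values_balList) (card_hull_eq_sum_balList (Nat.succ_pos _))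
      (strictAnti_one_div_add i) (Nat.div_pos (by omega) (by omega))
      (by rwa [length_balList])
  have hle := Finset.sum_lt_sum_of_nonempty
    (Finset.nonempty_range_iff.2 (hG.connected.pos_dist_of_ne hva).ne') hcross
  have heq := sum_cross_eq (G.dist v a) (balList (#A + 1) (#(G.hull c A) - 1))
  have hbal := spiderHarary_le_of_isBal
    (l := G.dist v a :: balList (#A + 1) (#(G.hull c A) - 1))
    (isBal_balList (#A + 2) (#(G.hull c (insert a A)) - 1))
    (by simp [length_balList])
    (by
      rw [List.sum_cons, sum_balList (Nat.succ_pos _), sum_balList (Nat.succ_pos _), hcard]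
      omega)
  rw [spiderHarary] at hbal
  have := recipSum_hull_le hG c A hcA
  rw [hsum]
  linarith

end SimpleGraph

lemma exists_perm_of_ofFn_perm {k : ℕ} {L L' : Fin k → ℕ}
    (h : (List.ofFn L).Perm (List.ofFn L')) : ∃ σ : Equiv.Perm (Fin k), L ∘ σ = L' := by
  have e : L ∘ Tuple.sort L = L' ∘ Tuple.sort L' := List.ofFn_injective
    (List.Perm.eq_of_sortedLE (Tuple.monotone_sort L).sortedLE_ofFn
      (Tuple.monotone_sort L').sortedLE_ofFn
      (((Tuple.sort L).ofFn_comp_perm L).trans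
        (h.trans ((Tuple.sort L').ofFn_comp_perm L').symm)))
  refine ⟨(Tuple.sort L').symm.trans (Tuple.sort L), funext fun i => ?_⟩
  simpa using congrFun e ((Tuple.sort L').symm i)

namespace SimpleGraph

variable {V W : Type*} {G : SimpleGraph V}

/-- A function is the graph distance if it grows by at most one along edges, and every vertex
has a neighbor that is closer to the origin by one. -/
lemma dist_eq_of_step (D : V → V → ℕ) (h0 : ∀ x, D x x = 0)
    (hadj : ∀ x y z, G.Adj y z → D x z ≤ D x y + 1)
    (hstep : ∀ x y, x ≠ y → ∃ z, G.Adj z y ∧ D x z + 1 = D x y) (x y : V) :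
    G.dist x y = D x y := by
  have hle : ∀ {u v : V} (w : G.Walk u v), D x v ≤ D x u + w.length := by
    intro u v w
    induction w with
    | nil => simp
    | cons h p ih =>
      have := hadj x _ _ h
      rw [Walk.length_cons]
      omega
  have hex : ∀ n y, D x y = n → ∃ w : G.Walk x y, w.length = n := by
    intro n
    induction n with
    | zero =>
      intro y hy
      rcases eq_or_ne x y with rfl | hne
      · exact ⟨.nil, rfl⟩
      · obtain ⟨z, -, hz⟩ := hstep x y hne
        omega
    | succ n ih =>
      intro y hy
      have hne : x ≠ y := by
        rintro rfl
        rw [h0] at hy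
        omega
      obtain ⟨z, hz, hz'⟩ := hstep x y hne
      obtain ⟨w, hw⟩ := ih z (by omega)
      exact ⟨w.concat hz, by rw [Walk.length_concat, hw]⟩
  obtain ⟨w, hw⟩ := hex _ y rfl
  refine le_antisymm (hw ▸ dist_le w) ?_
  obtain ⟨p, hp⟩ := w.reachable.exists_walk_length_eq_dist
  have := hle p
  rw [h0] at this
  omega

lemma Iso.dist_eq {H : SimpleGraph W} (e : G ≃g H) (hG : G.Connected) (x y : V) :
    H.dist (e x) (e y) = G.dist x y := by
  have hH : H.Connected := (Iso.connected_iff e).1 hG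
  refine le_antisymm ?_ ?_
  · obtain ⟨p, hp⟩ := hG.exists_walk_length_eq_dist x y
    have := dist_le (p.map e.toHom)
    rwa [Walk.length_map, hp] at this
  · obtain ⟨p, hp⟩ := hH.exists_walk_length_eq_dist (e x) (e y)
    have := dist_le (p.map e.symm.toHom)
    rw [Walk.length_map, hp] at this
    simpa using this

lemma Iso.harary_eq [Fintype V] [Fintype W] {H : SimpleGraph W} (e : G ≃g H)
    (hG : G.Connected) : harary G = harary H := by
  rw [SimpleGraph.harary_eq, SimpleGraph.harary_eq, recipSum, recipSum,
    ← Equiv.sum_comp e.toEquiv]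
  congr 1
  refine Finset.sum_congr rfl fun x _ => ?_
  rw [← Equiv.sum_comp e.toEquiv]
  refine Finset.sum_congr rfl fun y _ => ?_
  rw [← e.dist_eq hG]
  rfl

end SimpleGraph

section Spider

variable {k : ℕ} {L : Fin k → ℕ}

/-- The distance between two vertices of a spider. -/
def spiderDist : Option (Σ i : Fin k, Fin (L i)) → Option (Σ i : Fin k, Fin (L i)) → ℕ
  | none, none => 0
  | none, some y => y.2 + 1
  | some x, none => x.2 + 1
  | some x, some y =>
    if x.1 = y.1 then ((x.2 : ℕ) - y.2) + ((y.2 : ℕ) - x.2) else x.2 + y.2 + 2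

lemma spider_adj_none_some {i : Fin k} {j : Fin (L i)} :
    (spider L).Adj none (some ⟨i, j⟩) ↔ (j : ℕ) = 0 := by
  rw [spider, SimpleGraph.fromRel_adj]
  constructor
  · rintro ⟨-, (⟨i', j', -, h, h'⟩ | ⟨i', j', j'', h, -⟩) |
      (⟨i', j', h, -⟩ | ⟨i', j', j'', -, h, -⟩)⟩
    · cases h
      exact h'
    all_goals cases h
  · exact fun h => ⟨by simp, .inl (.inl ⟨i, j, rfl, rfl, h⟩)⟩

lemma spider_adj_some_some {i i' : Fin k} {j : Fin (L i)} {j' : Fin (L i')} :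
    (spider L).Adj (some ⟨i, j⟩) (some ⟨i', j'⟩) ↔
      i = i' ∧ ((j' : ℕ) = j + 1 ∨ (j : ℕ) = j' + 1) := by
  rw [spider, SimpleGraph.fromRel_adj]
  constructor
  · rintro ⟨-, (⟨_, _, h, -⟩ | ⟨a, b, c, h, h', h''⟩) |
      (⟨_, _, h, -⟩ | ⟨a, b, c, h, h', h''⟩)⟩
    · cases h
    · cases h
      cases h'
      exact ⟨rfl, .inl h''⟩
    · cases h
    · cases h
      cases h'
      exact ⟨rfl, .inr h''⟩
  · rintro ⟨rfl, h⟩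
    refine ⟨fun e => ?_, ?_⟩
    · cases e
      omega
    · rcases h with h | h
      · exact .inl (.inr ⟨i, j, j', rfl, rfl, h⟩)
      · exact .inr (.inr ⟨i, j', j, rfl, rfl, h⟩)

lemma spider_dist (x y : Option (Σ i : Fin k, Fin (L i))) :
    (spider L).dist x y = spiderDist x y := by
  refine SimpleGraph.dist_eq_of_step spiderDist ?_ ?_ ?_ x y
  · rintro (_ | ⟨i, j⟩) <;> simp [spiderDist]
  · rintro x (_ | ⟨i, j⟩) (_ | ⟨i', j'⟩) h
    · exact absurd h (spider L).irrefl
    · rw [spider_adj_none_some] at h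
      rcases x with _ | ⟨a, b⟩
      · simp [spiderDist, h]
      · simp only [spiderDist, h]
        split_ifs <;> omega
    · have h := spider_adj_none_some.1 h.symm
      rcases x with _ | ⟨a, b⟩
      · simp [spiderDist]
      · simp only [spiderDist, h]
        split_ifs <;> omega
    · obtain ⟨rfl, h⟩ := spider_adj_some_some.1 h
      rcases x with _ | ⟨a, b⟩
      · simp only [spiderDist]
        omega
      · simp only [spiderDist]
        split_ifs <;> omega
  · rintro x (_ | ⟨i, j⟩) hxy
    · rcases x with _ | ⟨a, b⟩
      · exact absurd rfl hxy
      rcases Nat.eq_zero_or_pos b with hb | hb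
      · exact ⟨some ⟨a, b⟩, (spider_adj_none_some.2 hb).symm, by simp [spiderDist, hb]⟩
      · refine ⟨some ⟨a, ⟨0, by omega⟩⟩, (spider_adj_none_some.2 rfl).symm, ?_⟩
        simp [spiderDist]
    · by_cases hup : ∃ b : Fin (L i), x = some ⟨i, b⟩ ∧ (j : ℕ) < b
      · obtain ⟨b, rfl, hb⟩ := hup
        refine ⟨some ⟨i, ⟨j + 1, by omega⟩⟩, spider_adj_some_some.2 ⟨rfl, .inr rfl⟩, ?_⟩
        simp only [spiderDist, if_true]
        omega
      have hdown : ∀ b : Fin (L i), x = some ⟨i, b⟩ → (b : ℕ) < j := by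
        rintro b rfl
        refine lt_of_le_of_ne (not_lt.1 fun h => hup ⟨b, rfl, h⟩) fun h => hxy ?_
        rw [Fin.ext h]
      rcases Nat.eq_zero_or_pos j with hj | hj
      · refine ⟨none, spider_adj_none_some.2 hj, ?_⟩
        rcases x with _ | ⟨a, b⟩
        · simp [spiderDist, hj]
        · have hne : a ≠ i := by
            rintro rfl
            have := hdown b rfl
            omega
          simp [spiderDist, hj, hne]
      · refine ⟨some ⟨i, ⟨j - 1, by omega⟩⟩, spider_adj_some_some.2 ⟨rfl, .inl ?_⟩, ?_⟩
        · simp only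
          omega
        · rcases x with _ | ⟨a, b⟩
          · simp only [spiderDist]
            omega
          · simp only [spiderDist]
            split_ifs with h
            · subst h
              have := hdown b rfl
              omega
            · omega

lemma sum_legs_eq_spiderHarary (L : Fin k → ℕ) :
    ∑ i, ∑ i', (if i = i' then 2 * legSum (L i) else crossSum (L i) (L i')) =
      2 * spiderHarary (List.ofFn L) := by
  induction k with
  | zero => simp [spiderHarary]
  | succ k ih =>
    rw [List.ofFn_succ, spiderHarary, List.map_ofFn, List.sum_ofFn]
    simp only [Fin.sum_univ_succ, Fin.succ_inj, if_true, Finset.sum_add_distrib, ih,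
      (Fin.succ_ne_zero _).symm, Fin.succ_ne_zero, if_false, Function.comp_apply]
    rw [Finset.sum_congr rfl fun i _ => crossSum_comm (L (Fin.succ i)) (L 0)]
    ring

lemma harary_spider (L : Fin k → ℕ) : harary (spider L) = spiderHarary (List.ofFn L) := by
  have hsame : ∀ i, ∑ j : Fin (L i), ∑ j' : Fin (L i),
      1 / (((j : ℕ) - j' + (j' - j) : ℕ) : ℝ) + 2 * ∑ j : Fin (L i), 1 / ((j + 1 : ℕ) : ℝ) =
      2 * legSum (L i) := by
    intro i
    rw [legSum_eq, mul_add, ← sum_range_path,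
      Fin.sum_univ_eq_sum_range (fun j => 1 / ((j + 1 : ℕ) : ℝ)),
      ← Fin.sum_univ_eq_sum_range
        (fun j => ∑ j' ∈ range (L i), 1 / ((j - j' + (j' - j) : ℕ) : ℝ)), add_comm]
    congr 1
    exact Finset.sum_congr rfl fun j _ =>
      Fin.sum_univ_eq_sum_range (fun j' => 1 / (((j : ℕ) - j' + (j' - j) : ℕ) : ℝ)) _
  have hcross : ∀ i i', ∑ j : Fin (L i), ∑ j' : Fin (L i'), 1 / ((j + j' + 2 : ℕ) : ℝ) =
      crossSum (L i) (L i') := by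
    intro i i'
    rw [crossSum, ← Fin.sum_univ_eq_sum_range
      (fun j => ∑ j' ∈ range (L i'), 1 / ((j + j' + 2 : ℕ) : ℝ))]
    exact Finset.sum_congr rfl fun j _ =>
      Fin.sum_univ_eq_sum_range (fun j' => 1 / ((j + j' + 2 : ℕ) : ℝ)) _
  have hrow : ∀ i, ∑ j : Fin (L i), ∑ i', ∑ j' : Fin (L i'),
      1 / ((if i = i' then ((j : ℕ) - j') + (j' - j) else j + j' + 2 : ℕ) : ℝ) +
        2 * ∑ j : Fin (L i), 1 / ((j + 1 : ℕ) : ℝ) =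
      ∑ i', (if i = i' then 2 * legSum (L i) else crossSum (L i) (L i')) := by
    intro i
    rw [Finset.sum_comm, ← Finset.add_sum_erase _ _ (Finset.mem_univ i),
      ← Finset.add_sum_erase (a := i) _ _ (Finset.mem_univ i)]
    simp only [if_true]
    rw [← hsame, add_right_comm]
    congr 1
    refine Finset.sum_congr rfl fun i' hi' => ?_
    have hne : i ≠ i' := (Finset.ne_of_mem_erase hi').symm
    simp only [hne, if_false]
    exact hcross i i'
  rw [SimpleGraph.harary_eq, div_eq_iff two_ne_zero, mul_comm, ← sum_legs_eq_spiderHarary,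
    ← Finset.sum_congr rfl fun i _ => hrow i, SimpleGraph.recipSum]
  simp only [spider_dist, Fintype.sum_option, Fintype.sum_sigma, spiderDist,
    Finset.sum_add_distrib, ← Finset.mul_sum]
  simp
  ring

/-- A tree all of whose vertices lie on geodesics from `v` to `l i`, with these geodesics
meeting only in `v`, is a spider with center `v`. -/
lemma nonempty_iso_spider {V : Type*} {T : SimpleGraph V} (hT : T.IsTree) {v : V} {l : Fin k → V}
    (hcov : ∀ x, ∃ i, T.Btw v x (l i)) (hL : ∀ i, T.dist v (l i) = L i)
    (hdisj : ∀ i i' x, T.Btw v x (l i) → T.Btw v x (l i') → x ≠ v → i = i') :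
    Nonempty (T ≃g spider L) := by
  have hc := hT.connected
  have hex : ∀ (i : Fin k) (j : Fin (L i)), ∃ x, T.dist v x = j + 1 ∧ T.Btw v x (l i) :=
    fun i j => hc.exists_btw v (l i) (by rw [hL]; omega)
  choose p hp using hex
  let φ : Option (Σ i : Fin k, Fin (L i)) → V
    | none => v
    | some x => p x.1 x.2
  have hdist : ∀ x y, T.dist (φ x) (φ y) = spiderDist x y := by
    rintro (_ | ⟨i, j⟩) (_ | ⟨i', j'⟩)
    · simp [φ, spiderDist]
    · exact (hp i' j').1
    · rw [T.dist_comm]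
      exact (hp i j).1
    · obtain ⟨h1, h2⟩ := hp i j
      obtain ⟨h3, h4⟩ := hp i' j'
      simp only [spiderDist, φ]
      split_ifs with h
      · subst h
        rcases le_total (j : ℕ) j' with h | h
        · have := h2.btw_of_dist_le hT h4 (by omega)
          unfold SimpleGraph.Btw at this
          omega
        · have := h4.btw_of_dist_le hT h2 (by omega)
          unfold SimpleGraph.Btw at this
          rw [T.dist_comm (u := p i j)]
          omega
      · obtain ⟨m, hm1, hm2, hm3⟩ := hT.exists_median (p i j) (p i' j') v
        have hmv : m = v := by
          by_contra hmv
          exact h (hdisj i i' m (hm2.trans hc h2) (hm3.trans hc h4) hmv)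
        subst hmv
        unfold SimpleGraph.Btw at hm1
        rw [T.dist_comm (u := p i j)] at hm1
        omega
  have hinj : Function.Injective φ := by
    intro x y hxy
    have h := hdist x y
    rw [hxy, SimpleGraph.dist_self] at h
    rcases x with _ | ⟨i, j⟩ <;> rcases y with _ | ⟨i', j'⟩ <;> simp only [spiderDist] at h
    · rfl
    · omega
    · omega
    · split_ifs at h with hi
      subst hi
      rw [show j = j' from Fin.ext (by omega)]
  have hsurj : Function.Surjective φ := by
    intro x
    rcases eq_or_ne x v with rfl | hxv
    · exact ⟨none, rfl⟩
    obtain ⟨i, hi⟩ := hcov x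
    have hpos := hc.pos_dist_of_ne hxv.symm
    have hle : T.dist v x ≤ L i := by
      rw [← hL]
      unfold SimpleGraph.Btw at hi
      omega
    refine ⟨some ⟨i, ⟨T.dist v x - 1, by omega⟩⟩, ?_⟩
    obtain ⟨h1, h2⟩ := hp i ⟨T.dist v x - 1, by omega⟩
    exact h2.eq_of_dist_eq hT hi (by simp only at h1; omega)
  refine ⟨SimpleGraph.Iso.symm ⟨Equiv.ofBijective φ ⟨hinj, hsurj⟩, fun {x y} => ?_⟩⟩
  change T.Adj (φ x) (φ y) ↔ _
  rw [← SimpleGraph.dist_eq_one_iff_adj, hdist, ← spider_dist, SimpleGraph.dist_eq_one_iff_adj]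

end Spider

namespace SimpleGraph

variable {V : Type*} {G : SimpleGraph V}

/-- If a tree with `k` leaves has a vertex `v` with at least `k` neighbours, the geodesics from
`v` to distinct leaves meet only in `v`. -/
lemma IsTree.eq_of_btw_of_btw_of_card_le [Fintype V] (hG : G.IsTree) {k : ℕ}
    {v : V} {l : Fin k → V} (hcov : ∀ x, ∃ i, G.Btw v x (l i))
    (hdeg : k ≤ #{x | G.dist v x = 1}) {i i' : Fin k} {x : V} (hx : G.Btw v x (l i))
    (hx' : G.Btw v x (l i')) (hxv : x ≠ v) : i = i' := by
  have hc := hG.connected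
  choose g hg using hcov
  have hinj : Set.InjOn g (({x | G.dist v x = 1} : Finset V) : Set V) := by
    intro y hy z hz hyz
    simp only [coe_filter, mem_univ, true_and, Set.mem_ofPred_eq] at hy hz
    exact (hg y).eq_of_dist_eq hG (hyz ▸ hg z) (hy.trans hz.symm)
  have hsurj := surjOn_of_injOn_of_card_le g (s := {x | G.dist v x = 1}) (t := univ)
    (fun _ _ => by simp) hinj (by simpa using hdeg)
  obtain ⟨y, hy1, hy⟩ := hc.exists_btw v x (t := 1) (hc.pos_dist_of_ne hxv.symm)
  have key : ∀ j, G.Btw v x (l j) → g y = j := by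
    intro j hj
    obtain ⟨z, hz, rfl⟩ := hsurj (mem_coe.2 (mem_univ j))
    simp only [coe_filter, mem_univ, true_and, Set.mem_ofPred_eq] at hz
    rw [(hy.trans hc hj).eq_of_dist_eq hG (hg z) (hy1.trans hz.symm)]
  rw [← key i hx, key i' hx']

end SimpleGraph

/-- A tree whose `k` leaves are enumerated by `l`, with a vertex `v` that is not a leaf and has at
least `k` neighbours, has the Harary index of the balanced spider only if it is that spider. -/
lemma nonempty_iso_BS_of_harary_eq {V : Type*} [Fintype V] {T : SimpleGraph V}
    (hT : T.IsTree) {k : ℕ} (hk : 3 ≤ k) {v : V} {l : Fin k → V}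
    (hcov : ∀ x, ∃ i, T.Btw v x (l i)) (hl : ∀ i, v ≠ l i)
    (hdeg : k ≤ #{x | T.dist v x = 1})
    (heq : harary T = harary (BS (Fintype.card V) k)) :
    Nonempty (T ≃g BS (Fintype.card V) k) := by
  have hdisj : ∀ i i' x, T.Btw v x (l i) → T.Btw v x (l i') → x ≠ v → i = i' :=
    fun i i' x h h' hx => hT.eq_of_btw_of_btw_of_card_le hcov hdeg h h' hx
  obtain ⟨e⟩ := nonempty_iso_spider hT (L := fun i => T.dist v (l i)) hcov (fun _ => rfl) hdisj
  have hcard := Fintype.card_congr e.toEquiv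
  simp only [Fintype.card_option, Fintype.card_sigma, Fintype.card_fin] at hcard
  have hofFn : List.ofFn (balancedLegs (Fintype.card V) k) = balList k (Fintype.card V - 1) := rfl
  rw [Iso.harary_eq e hT.connected, BS, harary_spider, harary_spider, hofFn] at heq
  have hbal' := isBal_balList k (Fintype.card V - 1)
  have hlen : (List.ofFn fun i => T.dist v (l i)).length
      = (balList k (Fintype.card V - 1)).length := by
    rw [length_balList, List.length_ofFn]
  have hsum : (List.ofFn fun i => T.dist v (l i)).sum
      = (balList k (Fintype.card V - 1)).sum := by
    rw [sum_balList (by omega), List.sum_ofFn]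
    omega
  have hbal : IsBal (List.ofFn fun i => T.dist v (l i)) := by
    by_contra hb
    refine (spiderHarary_lt_of_isBal hbal' hlen hsum (by simpa using hk) ?_ hb).ne heq
    intro m hm
    obtain ⟨i, rfl⟩ := (List.mem_ofFn' _ _).1 hm
    exact hT.connected.pos_dist_of_ne (hl i)
  obtain ⟨σ, hσ⟩ := exists_perm_of_ofFn_perm (hofFn ▸ hbal.perm hbal' hlen hsum)
  refine nonempty_iso_spider hT (v := v) (l := l ∘ σ) (fun x => ?_) (fun i => congrFun hσ i)
    fun i i' x h h' hx => σ.injective (hdisj _ _ x h h' hx)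
  obtain ⟨i, hi⟩ := hcov x
  exact ⟨σ.symm i, by simpa using hi⟩

theorem harary_pendent_vertices_max {V : Type*} [Fintype V] (T : SimpleGraph V)
    (hT : T.IsTree) (n k : ℕ) (hk3 : 3 ≤ k) (hkn : k ≤ n - 2)
    (hcard : Fintype.card V = n) (hpend : {v : V | deg T v = 1}.ncard = k) :
    harary T ≤ harary (BS n k) ∧
    (harary T = harary (BS n k) ↔ Nonempty (T ≃g BS n k)) := by
  classical
  subst hcard
  have hc := hT.connected
  have : Nontrivial V := Fintype.one_lt_card_iff_nontrivial.1 (by omega)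
  set n := Fintype.card V with hn
  have hBS : harary (BS n k) = spiderHarary (balList k (n - 1)) := harary_spider _
  let Lv : Finset V := {v | deg T v = 1}
  have hmem : ∀ x, x ∈ Lv ↔ deg T x = 1 := fun x => by simp [Lv]
  have hLv : #Lv = k := by
    rw [← hpend, ← Set.ncard_coe_finset]
    simp [Lv]
  obtain ⟨c, hcL, a, haL, hca⟩ := one_lt_card.1 (show 1 < #Lv by omega)
  let A := (Lv.erase c).erase a
  have hcA : c ∉ A := by simp [A]
  have hins : insert a A = Lv.erase c := insert_erase (mem_erase.2 ⟨hca.symm, haL⟩)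
  have hcE : c ∉ insert a A := by simp [hins]
  have hcardE : #(insert a A) + 1 = k := by
    rw [hins, card_erase_add_one hcL, hLv]
  have hcardA : #A + 2 = k := by
    rw [card_insert_of_notMem (by simp [A])] at hcardE
    omega
  have hAL : ∀ x ∈ A, deg T x = 1 := fun x hx =>
    (hmem x).1 (mem_of_mem_erase (mem_of_mem_erase hx))
  have huniv : T.hull c (insert a A) = univ := by
    refine eq_univ_of_forall fun x => mem_hull.2 ?_
    obtain ⟨l, hl, hx⟩ := hT.exists_leaf_btw c x
    rcases eq_or_ne l c with rfl | hlc
    · left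
      unfold SimpleGraph.Btw at hx
      rw [SimpleGraph.dist_self] at hx
      exact (hc.dist_eq_zero_iff.1 (by omega)).symm
    · exact Or.inr ⟨l, hins ▸ mem_erase.2 ⟨hlc, (hmem l).2 hl⟩, hx⟩
  have hle : harary T ≤ harary (BS n k) := by
    have := recipSum_hull_le hT c (insert a A) hcE
    rw [huniv, hcardE, card_univ, ← hn] at this
    rw [hBS, SimpleGraph.harary_eq]
    linarith
  refine ⟨hle, fun heq => ?_, fun ⟨e⟩ => Iso.harary_eq e hc⟩
  obtain ⟨v, hv, hgate⟩ := exists_gate hT c A a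
  have hah : a ∉ T.hull c A := by
    intro h
    rcases mem_hull.1 h with h | ⟨b, hb, h⟩
    · exact hca h.symm
    · rcases h.eq_or_eq_of_leaf hT ((hmem a).1 haL) with h | h
      · exact hca h.symm
      · exact (ne_of_mem_erase hb) h.symm
  have hva : v ≠ a := fun h => hah (h ▸ hv)
  have hsub : insert c A ⊆ T.hull c A := by
    intro x hx
    rcases mem_insert.1 hx with rfl | hx
    · exact mem_hull.2 (Or.inl rfl)
    · exact mem_hull.2 (Or.inr ⟨x, hx, btw_right _ _⟩)
  have hvleaf : deg T v ≠ 1 := by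
    intro h
    have hall : ∀ x ∈ insert c A, v = x := fun x hx =>
      ((hgate x (hsub hx)).eq_or_eq_of_leaf hT h).resolve_right hva
    obtain ⟨b, hb⟩ : A.Nonempty := card_pos.1 (by omega)
    have := (hall c (mem_insert_self _ _)).symm.trans (hall b (mem_insert_of_mem hb))
    exact hcA (this ▸ hb)
  have hbig : #A + 1 < #(T.hull c A) := by
    rw [← card_insert_of_notMem hcA]
    refine card_lt_card ((ssubset_iff_of_subset hsub).2 ⟨v, hv, fun h => hvleaf ?_⟩)
    rcases mem_insert.1 h with rfl | h
    · exact (hmem _).1 hcL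
    · exact hAL v h
  have hdegA : #A + 1 ≤ #{x ∈ T.hull c A | T.dist v x = 1} := by
    by_contra! hlt
    have := recipSum_hull_insert_lt hT hcA hv hgate hva hbig hlt
    rw [huniv, hcardA, card_univ, ← hn] at this
    rw [hBS, SimpleGraph.harary_eq] at heq
    linarith
  have hdeg : k ≤ #{x | T.dist v x = 1} := by
    obtain ⟨w, hw1, hw⟩ := hc.exists_btw v a (t := 1) (hc.pos_dist_of_ne hva)
    have hwh : w ∉ T.hull c A := by
      intro h
      have := hgate w h
      unfold SimpleGraph.Btw at this hw
      rw [T.dist_comm (u := w) (v := v)] at this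
      omega
    have : insert w {x ∈ T.hull c A | T.dist v x = 1} ⊆
        ({x | T.dist v x = 1} : Finset V) := by
      intro x hx
      rcases mem_insert.1 hx with rfl | hx
      · simpa using hw1
      · simpa using (mem_filter.1 hx).2
    have := card_le_card this
    rw [card_insert_of_notMem (by simp [hwh])] at this
    omega
  let f := (Lv.equivFinOfCardEq hLv).symm
  refine nonempty_iso_BS_of_harary_eq hT hk3 (v := v) (l := fun i => (f i : V)) (fun x => ?_)
    (fun i h => hvleaf (h ▸ (hmem _).1 (f i).2)) hdeg heq
  obtain ⟨l, hl, hx⟩ := hT.exists_leaf_btw v x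
  exact ⟨f.symm ⟨l, (hmem l).2 hl⟩, by simpa using hx⟩
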